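/- Let (μ_t)_{t≥0} be a family of Borel probability measures on ℝ such that μ_0 = δ_0, μ_{t+s} = μ_t * μ_s for all s, t ≥ 0, and t ↦ μ_t is weakly continuous, and let f : ℝ → ℂ satisfy μ̂_t(α) = exp(t f(α)) for all t ≥ 0 and α ∈ ℝ (so that Re f(α) ≤ 0). Then for every q > 0, ξ ≥ 0, and α ∈ ℝ, the iterated integrals I⁺ = ∫₀^∞ ∫_{[0,∞)} (e^{−ξt + iαx} − 1) t^{−1} e^{−qt} μ_t(dx) dt and I⁻ = ∫₀^∞ ∫_{(−∞,0)} (e^{−ξt + iαx} − 1) t^{−1} e^{−qt} μ_t(dx) dt are well defined and finite, and q / (q + ξ − f(α)) = exp(I⁺) · exp(I⁻). -/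

import Mathlib

open MeasureTheory
open scoped BoundedContinuousFunction

/-- The complex exponential is Lipschitz with constant `exp c` on the half-plane `re ≤ c`. -/
lemma Complex.norm_exp_sub_exp_le {c : ℝ} {v w : ℂ} (hv : v.re ≤ c) (hw : w.re ≤ c) :
    ‖Complex.exp w - Complex.exp v‖ ≤ Real.exp c * ‖w - v‖ := by
  refine (convex_halfSpace_re_le c).norm_image_sub_le_of_norm_hasDerivWithin_le
    (fun x _ => (Complex.hasDerivAt_exp x).hasDerivWithinAt) (fun x hx => ?_) hv hw
  rw [Complex.norm_exp]
  exact Real.exp_le_exp.mpr hx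

lemma integrableOn_exp_neg_sub_exp_neg_div {a b : ℂ} (ha : 0 < a.re) (hb : 0 < b.re) :
    IntegrableOn (fun t : ℝ => (Complex.exp (-a * t) - Complex.exp (-b * t)) / t)
      (Set.Ioi (0 : ℝ)) := by
  have hm : 0 < min a.re b.re := lt_min ha hb
  refine Integrable.mono'
    ((integrableOn_exp_mul_Ioi (neg_lt_zero.mpr hm) 0).const_mul ‖a - b‖)
    (Measurable.aestronglyMeasurable (by fun_prop)) ?_
  filter_upwards [ae_restrict_mem measurableSet_Ioi] with t ht
  have ht : 0 < t := ht
  have h := Complex.norm_exp_sub_exp_le (c := -min a.re b.re * t) (v := -b * t) (w := -a * t)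
    (by simpa using mul_le_mul_of_nonneg_right (min_le_right a.re b.re) ht.le)
    (by simpa using mul_le_mul_of_nonneg_right (min_le_left a.re b.re) ht.le)
  have h' : ‖-a * (t : ℂ) - -b * t‖ = ‖a - b‖ * t := by
    rw [show -a * (t : ℂ) - -b * t = -((a - b) * t) by ring, norm_neg, norm_mul,
      Complex.norm_of_nonneg ht.le]
  rw [h'] at h
  rw [norm_div, Complex.norm_of_nonneg ht.le, div_le_iff₀ ht]
  linarith

lemma hasDerivAt_integral_exp_neg_sub_exp_neg_div {a b : ℂ} (ha : 0 < a.re) (hb : 0 < b.re) :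
    HasDerivAt (fun z : ℂ => ∫ t in Set.Ioi (0 : ℝ),
      (Complex.exp (-z * t) - Complex.exp (-b * t)) / t) (-a⁻¹) a := by
  have hs : {z : ℂ | a.re / 2 < z.re} ∈ nhds a :=
    (isOpen_lt continuous_const Complex.continuous_re).mem_nhds
      (show a.re / 2 < a.re by linarith)
  have h := (hasDerivAt_integral_of_dominated_loc_of_deriv_le
    (μ := volume.restrict (Set.Ioi (0 : ℝ)))
    (F := fun (z : ℂ) (t : ℝ) => (Complex.exp (-z * t) - Complex.exp (-b * t)) / t)
    (F' := fun (z : ℂ) (t : ℝ) => -Complex.exp (-z * t))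
    (bound := fun t : ℝ => Real.exp (-(a.re / 2) * t)) hs
    (Filter.Eventually.of_forall fun z => Measurable.aestronglyMeasurable (by fun_prop))
    (integrableOn_exp_neg_sub_exp_neg_div ha hb) (by fun_prop) ?_
    (integrableOn_exp_mul_Ioi (by linarith) 0) ?_).2
  · refine h.congr_deriv ?_
    rw [integral_neg, integral_exp_mul_complex_Ioi (by simpa using ha)]
    simp [neg_div_neg_eq]
  · filter_upwards [ae_restrict_mem measurableSet_Ioi] with t ht z hz
    have ht : 0 < t := ht
    have hz : a.re / 2 < z.re := hz
    rw [norm_neg, Complex.norm_exp]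
    refine Real.exp_le_exp.mpr ?_
    simp only [Complex.mul_re, Complex.neg_re, Complex.ofReal_re, Complex.neg_im,
      Complex.ofReal_im, mul_zero, sub_zero]
    nlinarith
  · filter_upwards [ae_restrict_mem measurableSet_Ioi] with t ht z _
    have ht : (t : ℂ) ≠ 0 := Complex.ofReal_ne_zero.mpr (ne_of_gt ht)
    have h1 : HasDerivAt (fun z : ℂ => -z * t) (-1 * t) z :=
      (hasDerivAt_id z).neg.mul_const _
    have h2 := ((h1.cexp).sub_const (Complex.exp (-b * t))).div_const (t : ℂ)
    refine h2.congr_deriv ?_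
    field_simp

/-- **Frullani's integral** for exponentials with complex rates, in exponentiated form. -/
lemma exp_integral_exp_neg_sub_exp_neg_div {a b : ℂ} (ha : 0 < a.re) (hb : 0 < b.re) :
    Complex.exp (∫ t in Set.Ioi (0 : ℝ), (Complex.exp (-a * t) - Complex.exp (-b * t)) / t)
      = b / a := by
  set F : ℂ → ℂ := fun z => ∫ t in Set.Ioi (0 : ℝ),
    (Complex.exp (-z * t) - Complex.exp (-b * t)) / t with hF
  have hd : ∀ z ∈ {z : ℂ | 0 < z.re}, HasDerivAt (fun z => z * Complex.exp (F z)) 0 z := by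
    intro z hz
    have hz0 : z ≠ 0 := by rintro rfl; simp at hz
    have hFd : HasDerivAt F (-z⁻¹) z := hasDerivAt_integral_exp_neg_sub_exp_neg_div hz hb
    refine ((hasDerivAt_id' z).mul hFd.cexp).congr_deriv ?_
    linear_combination -Complex.exp (F z) * mul_inv_cancel₀ hz0
  have hconst := (isOpen_lt continuous_const Complex.continuous_re).is_const_of_deriv_eq_zero
    (convex_halfSpace_re_gt 0).isPreconnected
    (fun z hz => (hd z hz).differentiableAt.differentiableWithinAt)
    (fun z hz => (hd z hz).deriv) ha hb
  have ha0 : a ≠ 0 := by rintro rfl; simp at ha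
  have hFb : F b = 0 := by simp [hF]
  simp only [hFb, Complex.exp_zero, mul_one] at hconst
  rw [eq_div_iff ha0, mul_comm]
  exact hconst

/-- A weakly continuous family of probability measures is measurable. -/
lemma measurable_of_continuousOn_integral {μ : ℝ → Measure ℝ}
    (hprob : ∀ t : ℝ, 0 ≤ t → IsProbabilityMeasure (μ t))
    (hweak : ∀ g : BoundedContinuousFunction ℝ ℝ,
      ContinuousOn (fun t : ℝ => ∫ x, g x ∂(μ t)) (Set.Ici (0 : ℝ))) :
    Measurable fun t : ℝ => μ (max t 0) := by
  have hp : ∀ t : ℝ, IsProbabilityMeasure (μ (max t 0)) := fun t => hprob _ (le_max_right _ _)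
  let ν : ℝ → ProbabilityMeasure ℝ := fun t => ⟨μ (max t 0), hp t⟩
  have hc : Continuous ν := by
    refine continuous_iff_continuousAt.mpr fun t => ?_
    refine ProbabilityMeasure.tendsto_iff_forall_integral_tendsto.mpr fun g => ?_
    have : Continuous fun t : ℝ => ∫ x, g x ∂(μ (max t 0)) :=
      (hweak g).comp_continuous (by fun_prop) fun t => le_max_right t 0
    exact this.tendsto t
  refine Measurable.measure_of_isPiSystem_of_isProbabilityMeasure
    (BorelSpace.measurable_eq.trans (borel_eq_generateFrom_isClosed (α := ℝ))) isPiSystem_isClosed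
    fun s hs => ?_
  refine measurable_of_tendsto_metrizable
    (f := fun n t => ∫⁻ x, hs.apprSeq n x ∂(μ (max t 0))) (fun n => ?_)
    (tendsto_pi_nhds.mpr fun t => ?_)
  · have h := (ProbabilityMeasure.continuous_testAgainstNN_eval (Ω := ℝ) (hs.apprSeq n)).comp hc
    convert (ENNReal.continuous_coe.comp h).measurable using 2 with t
    exact (FiniteMeasure.testAgainstNN_coe_eq (μ := (ν t).toFiniteMeasure)).symm
  · exact HasOuterApproxClosed.tendsto_lintegral_apprSeq hs (μ (max t 0))

/-- For `re z ≤ 0` `‖exp z - 1‖` is bounded by an affine function of `re (exp z - 1)`. -/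
lemma Complex.norm_exp_sub_one_le_of_re_nonpos {z : ℂ} (hz : z.re ≤ 0) {r : ℝ} (hr : 0 < r) :
    ‖Complex.exp z - 1‖ ≤ r / 2 - (Complex.exp z - 1).re / r := by
  have h1 : ‖Complex.exp z‖ ≤ 1 := by
    rw [Complex.norm_exp]; exact Real.exp_le_one_iff.mpr hz
  have h2 : ‖Complex.exp z - 1‖ ^ 2 ≤ -2 * (Complex.exp z - 1).re := by
    have h3 : ‖Complex.exp z‖ ^ 2 ≤ 1 := pow_le_one₀ (norm_nonneg _) h1
    rw [Complex.sq_norm, Complex.normSq_apply] at h3 ⊢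
    simp only [Complex.sub_re, Complex.sub_im, Complex.one_re, Complex.one_im]
    nlinarith
  have h4 : r / 2 - (Complex.exp z - 1).re / r = (r ^ 2 - 2 * (Complex.exp z - 1).re) / (2 * r) := by
    field_simp
  rw [h4, le_div_iff₀ (by positivity)]
  nlinarith [sq_nonneg (‖Complex.exp z - 1‖ - r)]

lemma integrable_exp_sub_one (ν : Measure ℝ) [IsFiniteMeasure ν] {c : ℝ} (hc : 0 ≤ c) (α : ℝ) :
    Integrable (fun x : ℝ => Complex.exp (-c + Complex.I * α * x) - 1) ν := by
  refine Integrable.sub (Integrable.of_bound (by fun_prop) 1 (Filter.Eventually.of_forall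
    fun x => ?_)) (integrable_const _)
  simpa [Complex.norm_exp] using hc

/-- The absolute moment `∫ ‖exp (-c + iαx) - 1‖` is controlled by the characteristic function. -/
lemma integral_norm_exp_sub_one_le (ν : Measure ℝ) [IsProbabilityMeasure ν] {c : ℝ} (hc : 0 ≤ c)
    (α : ℝ) {r : ℝ} (hr : 0 < r) :
    ∫ x : ℝ, ‖Complex.exp (-c + Complex.I * α * x) - 1‖ ∂ν ≤
      r / 2 + ‖∫ x : ℝ, (Complex.exp (-c + Complex.I * α * x) - 1) ∂ν‖ / r := by
  have hi := integrable_exp_sub_one ν hc α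
  calc ∫ x : ℝ, ‖Complex.exp (-c + Complex.I * α * x) - 1‖ ∂ν
      ≤ ∫ x : ℝ, (r / 2 - (Complex.exp (-c + Complex.I * α * x) - 1).re / r) ∂ν := by
        refine integral_mono hi.norm ((integrable_const _).sub (hi.re.div_const r)) fun x => ?_
        exact Complex.norm_exp_sub_one_le_of_re_nonpos (by simpa using hc) hr
    _ = r / 2 - (∫ x : ℝ, (Complex.exp (-c + Complex.I * α * x) - 1) ∂ν).re / r := by
        have h1 := integral_sub (integrable_const (μ := ν) (r / 2)) (hi.re.div_const r)
        have h2 := integral_re hi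
        simp only [RCLike.re_to_complex] at h1 h2
        rw [h1, integral_div r (fun x : ℝ => (Complex.exp (-c + Complex.I * α * x) - 1).re), h2]
        simp
    _ ≤ _ := by
        have := (abs_le.mp (Complex.abs_re_le_norm
          (∫ x : ℝ, (Complex.exp (-c + Complex.I * α * x) - 1) ∂ν))).1
        rw [sub_eq_add_neg, ← neg_div]
        gcongr
        linarith

/-- If `∫ (exp (-ξt + iαx) - 1) μ_t(dx) = O(t)`, the Spitzer integrand over any measurable set
is integrable in time. -/
lemma integrableOn_setIntegral_spitzer {μ : ℝ → Measure ℝ}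
    (hprob : ∀ t : ℝ, 0 ≤ t → IsProbabilityMeasure (μ t))
    (hmeas : Measurable fun t : ℝ => μ (max t 0))
    {q ξ α C : ℝ} (hq : 0 < q) (hξ : 0 ≤ ξ)
    (hC : ∀ t : ℝ, 0 < t →
      ‖∫ x : ℝ, (Complex.exp (-ξ * t + Complex.I * α * x) - 1) ∂(μ t)‖ ≤ C * t)
    {S : Set ℝ} (hS : MeasurableSet S) :
    IntegrableOn
      (fun t : ℝ => ∫ x in S,
        (Complex.exp (-ξ * t + Complex.I * α * x) - 1) * (Real.exp (-q * t) / t) ∂(μ t))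
      (Set.Ioi (0 : ℝ)) := by
  have hp : ∀ t : ℝ, IsProbabilityMeasure (μ (max t 0)) := fun t => hprob _ (le_max_right _ _)
  let κ : ProbabilityTheory.Kernel ℝ ℝ := ⟨fun t => μ (max t 0), hmeas⟩
  have : ProbabilityTheory.IsMarkovKernel κ := ⟨hp⟩
  have hsm : StronglyMeasurable fun t : ℝ => ∫ x, S.indicator (fun x : ℝ =>
      (Complex.exp (-ξ * t + Complex.I * α * x) - 1) * (Real.exp (-q * t) / t)) x ∂(κ t) := by
    refine StronglyMeasurable.integral_kernel_prod_right (κ := κ) (f := fun t : ℝ =>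
      S.indicator (fun x : ℝ =>
        (Complex.exp (-ξ * t + Complex.I * α * x) - 1) * (Real.exp (-q * t) / t))) ?_
    have : Measurable fun p : ℝ × ℝ =>
        (Complex.exp (-ξ * p.1 + Complex.I * α * p.2) - 1) * (Real.exp (-q * p.1) / p.1 : ℂ) := by
      fun_prop
    exact (this.indicator (measurable_snd hS)).stronglyMeasurable
  have hb := (integrableOn_rpow_mul_exp_neg_mul_rpow (p := 1) (s := -1 / 2) (b := q)
    (by norm_num) one_pos hq).const_mul (1 / 2 + C)
  refine Integrable.mono' hb ?_ ?_
  · refine hsm.aestronglyMeasurable.congr ?_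
    filter_upwards [ae_restrict_mem measurableSet_Ioi] with t ht
    have hκ : κ t = μ t := congrArg μ (max_eq_left (le_of_lt ht))
    rw [hκ, integral_indicator hS]
  · filter_upwards [ae_restrict_mem measurableSet_Ioi] with t ht
    have ht : 0 < t := ht
    have := hprob t ht.le
    have hpos : 0 ≤ Real.exp (-q * t) / t := by positivity
    have hcast : -(ξ : ℂ) * t = -((ξ * t : ℝ) : ℂ) := by push_cast; ring
    have hr : (0 : ℝ) < √t := Real.sqrt_pos.mpr ht
    have h1 := integral_norm_exp_sub_one_le (μ t) (mul_nonneg hξ ht.le) α hr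
    have h2 := hC t ht
    have hi := integrable_exp_sub_one (μ t) (mul_nonneg hξ ht.le) α
    rw [← hcast] at h1 hi
    have h3 : ∫ x : ℝ, ‖Complex.exp (-ξ * t + Complex.I * α * x) - 1‖ ∂(μ t) ≤
        (1 / 2 + C) * √t := by
      refine h1.trans ?_
      have : C * t / √t = C * √t := by rw [mul_div_assoc, Real.div_sqrt]
      have := div_le_div_of_nonneg_right h2 hr.le
      linarith
    have h4 : ∫ x in S, ‖Complex.exp (-ξ * t + Complex.I * α * x) - 1‖ ∂(μ t) ≤
        (1 / 2 + C) * √t :=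
      (setIntegral_le_integral hi.norm (Filter.Eventually.of_forall fun _ => norm_nonneg _)).trans h3
    have hw : ‖(Real.exp (-q * t) / t : ℂ)‖ = Real.exp (-q * t) / t := by
      rw [← Complex.ofReal_div, Complex.norm_of_nonneg hpos]
    rw [integral_mul_const, norm_mul, hw, Real.rpow_one]
    have h5 : t ^ (-1 / 2 : ℝ) = √t / t := by
      rw [Real.sqrt_eq_rpow, ← Real.rpow_sub_one ht.ne']
      norm_num
    rw [h5]
    calc _ ≤ ((1 / 2 + C) * √t) * (Real.exp (-q * t) / t) := by
          gcongr
          exact (norm_integral_le_integral_norm _).trans h4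
      _ = _ := by ring

/-- One-state Spitzer–Rogozin factorization: for a weakly continuous convolution semigroup
`(μ_t)_{t ≥ 0}` of probability measures on `ℝ` with `μ_0 = δ_0` and characteristic exponent
`f` (i.e. `∫ e^{iαx} μ_t(dx) = e^{t f(α)}`), for all `q > 0`, `ξ ≥ 0`, `α ∈ ℝ` the iterated
integrals `I⁺`, `I⁻` over the positive and negative half-lines are well defined and finite,
and `q / (q + ξ - f(α)) = exp I⁺ ⬝ exp I⁻`. -/
theorem spitzer_rogozin_levy
    (μ : ℝ → Measure ℝ)
    (hprob : ∀ t : ℝ, 0 ≤ t → IsProbabilityMeasure (μ t))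
    (h0 : μ 0 = Measure.dirac 0)
    (hconv : ∀ s t : ℝ, 0 ≤ s → 0 ≤ t → μ (t + s) = Measure.conv (μ t) (μ s))
    (hweak : ∀ g : BoundedContinuousFunction ℝ ℝ,
      ContinuousOn (fun t : ℝ => ∫ x, g x ∂(μ t)) (Set.Ici (0 : ℝ)))
    (f : ℝ → ℂ)
    (hf : ∀ t : ℝ, 0 ≤ t → ∀ α : ℝ,
      (∫ x, Complex.exp (Complex.I * α * x) ∂(μ t)) = Complex.exp (t * f α))
    (q ξ α : ℝ) (hq : 0 < q) (hξ : 0 ≤ ξ) :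
    (∀ t ∈ Set.Ioi (0 : ℝ), Integrable
      (fun x : ℝ => (Complex.exp (-ξ * t + Complex.I * α * x) - 1) * (Real.exp (-q * t) / t))
      ((μ t).restrict (Set.Ici (0 : ℝ)))) ∧
    (∀ t ∈ Set.Ioi (0 : ℝ), Integrable
      (fun x : ℝ => (Complex.exp (-ξ * t + Complex.I * α * x) - 1) * (Real.exp (-q * t) / t))
      ((μ t).restrict (Set.Iio (0 : ℝ)))) ∧
    IntegrableOn
      (fun t : ℝ => ∫ x in Set.Ici (0 : ℝ),
        (Complex.exp (-ξ * t + Complex.I * α * x) - 1) * (Real.exp (-q * t) / t) ∂(μ t))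
      (Set.Ioi (0 : ℝ)) ∧
    IntegrableOn
      (fun t : ℝ => ∫ x in Set.Iio (0 : ℝ),
        (Complex.exp (-ξ * t + Complex.I * α * x) - 1) * (Real.exp (-q * t) / t) ∂(μ t))
      (Set.Ioi (0 : ℝ)) ∧
    (q : ℂ) / ((q : ℂ) + (ξ : ℂ) - f α) =
      Complex.exp
        (∫ t in Set.Ioi (0 : ℝ), ∫ x in Set.Ici (0 : ℝ),
          (Complex.exp (-ξ * t + Complex.I * α * x) - 1) * (Real.exp (-q * t) / t) ∂(μ t)) *
      Complex.exp
        (∫ t in Set.Ioi (0 : ℝ), ∫ x in Set.Iio (0 : ℝ),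
          (Complex.exp (-ξ * t + Complex.I * α * x) - 1) * (Real.exp (-q * t) / t) ∂(μ t)) := by
  have hre : (f α).re ≤ 0 := by
    have := hprob 1 zero_le_one
    have h := norm_integral_le_of_norm_le_const (μ := μ 1) (C := 1)
      (f := fun x : ℝ => Complex.exp (Complex.I * α * x))
      (Filter.Eventually.of_forall fun x => by simp [Complex.norm_exp])
    rw [hf 1 zero_le_one α, Complex.norm_exp] at h
    simpa using h
  have hval : ∀ t : ℝ, 0 < t →
      ∫ x : ℝ, (Complex.exp (-ξ * t + Complex.I * α * x) - 1) ∂(μ t) =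
        Complex.exp (t * (f α - ξ)) - 1 := by
    intro t ht
    have := hprob t ht.le
    have hi : Integrable (fun x : ℝ => Complex.exp (Complex.I * α * x)) (μ t) :=
      Integrable.of_bound (by fun_prop) 1 (Filter.Eventually.of_forall fun x => by
        simp [Complex.norm_exp])
    simp only [Complex.exp_add]
    rw [integral_sub (hi.const_mul _) (integrable_const _), integral_const_mul, hf t ht.le α,
      ← Complex.exp_add]
    simp only [integral_const, probReal_univ, one_smul]
    ring_nf
  have hint : ∀ t : ℝ, 0 < t → Integrable (fun x : ℝ =>
      (Complex.exp (-ξ * t + Complex.I * α * x) - 1) * (Real.exp (-q * t) / t)) (μ t) := by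
    intro t ht
    have := hprob t ht.le
    have hcast : -(ξ : ℂ) * t = -((ξ * t : ℝ) : ℂ) := by push_cast; ring
    rw [hcast]
    exact (integrable_exp_sub_one (μ t) (mul_nonneg hξ ht.le) α).mul_const _
  have hC : ∀ t : ℝ, 0 < t →
      ‖∫ x : ℝ, (Complex.exp (-ξ * t + Complex.I * α * x) - 1) ∂(μ t)‖ ≤ ‖f α - ξ‖ * t := by
    intro t ht
    have h := Complex.norm_exp_sub_exp_le (c := 0) (v := 0) (w := t * (f α - ξ)) le_rfl
      (by simpa using mul_nonpos_of_nonneg_of_nonpos ht.le (by linarith : (f α).re - ξ ≤ 0))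
    rw [hval t ht]
    simpa [abs_of_pos ht, mul_comm] using h
  have hmeas := measurable_of_continuousOn_integral hprob hweak
  have hpos := integrableOn_setIntegral_spitzer hprob hmeas hq hξ hC measurableSet_Ici
    (S := Set.Ici (0 : ℝ))
  have hneg := integrableOn_setIntegral_spitzer hprob hmeas hq hξ hC measurableSet_Iio
    (S := Set.Iio (0 : ℝ))
  refine ⟨fun t ht => (hint t ht).restrict, fun t ht => (hint t ht).restrict, hpos, hneg, ?_⟩
  have ha : 0 < ((q : ℂ) + (ξ : ℂ) - f α).re := by
    simp only [Complex.sub_re, Complex.add_re, Complex.ofReal_re]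
    linarith
  rw [← Complex.exp_add, ← integral_add hpos hneg,
    ← exp_integral_exp_neg_sub_exp_neg_div ha (by simpa using hq : 0 < (q : ℂ).re)]
  congr 1
  refine setIntegral_congr_fun measurableSet_Ioi fun t ht => ?_
  have ht : 0 < t := ht
  have hsum := integral_add_compl (measurableSet_Ici (a := (0 : ℝ))) (hint t ht)
  rw [Set.compl_Ici] at hsum
  simp only [hsum]
  rw [integral_mul_const, hval t ht, ← mul_div_assoc, sub_mul, one_mul, Complex.ofReal_exp,
    ← Complex.exp_add]
  push_cast
  ring_nf
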